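/- arXiv:2011.01951 — 3 statements merged into one kernel-verified Lean document; each statement's English description precedes it below -/
import Mathlib

section
/- Let U be a unitary operator on H_N such that: (1) for every x ∈ G^N there exists y ∈ G^N with U|x⟩ = |y⟩; (2) for all g ∈ G and h ∈ G^{N−1} there exists g' ∈ G with U|g,hg⟩ = |g',hg'⟩; (3) for all g ∈ G and all x, y ∈ G^N, if |x⟩ = T_g|y⟩ then U|x⟩ = T_g(U|y⟩). Then there exists a function c : G^{N−1} → G such that U|g,hg⟩ = T_{c(h)}|g,hg⟩ = |c(h)g, h(c(h)g)⟩ for all g ∈ G and h ∈ G^{N−1}; conversely, every unitary of this form satisfies (1)–(3). -/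
noncomputable section

open Matrix

namespace QRF

section Defs

variable (G : Type) [Fintype G] [DecidableEq G] [CommGroup G]

/-- The `K`-particle Hilbert space `ℂ^{G^K}` (as functions `G^K → ℂ`). -/
abbrev Vec (K : ℕ) : Type := (Fin K → G) → ℂ

/-- Linear operators on the `K`-particle Hilbert space. -/
abbrev Op (K : ℕ) : Type := Matrix (Fin K → G) (Fin K → G) ℂ

variable {G}

/-- The standard basis vector `|x⟩`. -/
def ket {K : ℕ} (x : Fin K → G) : Vec G K := fun y => if y = x then 1 else 0

/-- The global translation `T_g`, `T_g |x₁,…,x_K⟩ = |g x₁, …, g x_K⟩`. -/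
def trans {K : ℕ} (g : G) : Op G K :=
  Matrix.of fun x y => if x = (fun i => g * y i) then 1 else 0

/-- The configuration `(g, h₁ g, …, h_k g)`, i.e. `|g, hg⟩`. -/
def cfg {k : ℕ} (h : Fin k → G) (g : G) : Fin (k + 1) → G :=
  Fin.cons g fun i => h i * g

/-- The inner product `⟨v, w⟩` (antilinear in the first argument). -/
def inn {K : ℕ} (v w : Vec G K) : ℂ := star v ⬝ᵥ w

/-- The rank-one operator `|v⟩⟨w|`. -/
def outer {K : ℕ} (v w : Vec G K) : Op G K :=
  Matrix.of fun x y => v x * (starRingEnd ℂ) (w y)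

/-- The matrix element `⟨v|A|w⟩`. -/
def melem {K : ℕ} (v : Vec G K) (A : Op G K) (w : Vec G K) : ℂ :=
  star v ⬝ᵥ A.mulVec w

/-- The Hilbert–Schmidt inner product `⟨A,B⟩ := tr(A† B)`. -/
def hsInner {K : ℕ} (A B : Op G K) : ℂ := (Aᴴ * B).trace

variable (G)

/-- The symmetry group `U_sym` of relation-conditional global translations
(for `k+1` particles). -/
def Usym (k : ℕ) : Set (Op G (k + 1)) :=
  {U | U ∈ Matrix.unitaryGroup (Fin (k + 1) → G) ℂ ∧
    ∃ c : (Fin k → G) → G, ∀ (h : Fin k → G) (g : G),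
      U.mulVec (ket (cfg h g)) = (trans (c h)).mulVec (ket (cfg h g))}

/-- The characters of `G`: monoid homomorphisms `G → ℂ` of modulus one. -/
def Ghat : Type := {χ : G →* ℂ // ∀ g : G, ‖χ g‖ = 1}

/-- The trivial character `𝟙`. -/
instance : One (Ghat G) := ⟨⟨1, fun g => by simp⟩⟩

variable {G}

/-- The vector `|h;χ⟩ := |G|^{-1/2} ∑_{g ∈ G} χ(g⁻¹) |g, hg⟩`. -/
def relKet {k : ℕ} (h : Fin k → G) (χ : Ghat G) : Vec G (k + 1) :=
  ((Real.sqrt (Fintype.card G) : ℂ))⁻¹ • ∑ g : G, χ.1 g⁻¹ • ket (cfg h g)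

variable (G)

/-- The relational subspace `H_phys = span{|h;𝟙⟩}`. -/
def Hphys (k : ℕ) : Submodule ℂ (Vec G (k + 1)) :=
  Submodule.span ℂ {v | ∃ h : Fin k → G, v = relKet h (1 : Ghat G)}

/-- `Π_phys = ∑_h |h;𝟙⟩⟨h;𝟙|`, the orthogonal projection onto `H_phys`. -/
def Piphys (k : ℕ) : Op G (k + 1) :=
  ∑ h : Fin k → G, outer (relKet h (1 : Ghat G)) (relKet h (1 : Ghat G))

variable {G}

/-- `Π_{h;χ≠𝟙} = ∑_{χ ∈ Ĝ, χ ≠ 𝟙} |h;χ⟩⟨h;χ|`. -/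
def PiNot1 {k : ℕ} (h : Fin k → G) : Op G (k + 1) :=
  ∑ᶠ (χ : Ghat G) (_ : χ ≠ 1), outer (relKet h χ) (relKet h χ)

variable (G)

/-- The invariant algebra `A_inv`. -/
def Ainv (k : ℕ) : Set (Op G (k + 1)) :=
  {A | ∀ U ∈ Usym G k, U * A * Uᴴ = A}

/-- The incoherent group average (twirl) `Π_inv` over `U_sym`. -/
def Piinv (k : ℕ) (ρ : Op G (k + 1)) : Op G (k + 1) :=
  (Nat.card ↥(Usym G k) : ℂ)⁻¹ • ∑ᶠ U ∈ Usym G k, U * ρ * Uᴴ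

/-- The algebra `A_phys` of relational observables (operators supported on `H_phys`). -/
def Aphys (k : ℕ) : Set (Op G (k + 1)) :=
  {A | A = Piphys G k * A * Piphys G k}

/-- The algebra `A_alg`. -/
def Aalg (k : ℕ) : Set (Op G (k + 1)) :=
  {X | ∃ B ∈ Aphys G k, ∃ a : (Fin k → G) → ℂ,
      X = B + ∑ h : Fin k → G, a h • PiNot1 h}

variable {G}

/-- The vector `|e⟩_i ⊗ φ`. -/
def insVec {k : ℕ} (i : Fin (k + 1)) (φ : (Fin k → G) → ℂ) : Vec G (k + 1) :=
  fun x => if x i = 1 then φ (fun j => x (i.succAbove j)) else 0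

/-- The operator `|e⟩⟨e|_i ⊗ A`. -/
def eAop {k : ℕ} (i : Fin (k + 1)) (A : Matrix (Fin k → G) (Fin k → G) ℂ) :
    Op G (k + 1) :=
  Matrix.of fun x y =>
    if x i = 1 ∧ y i = 1 then
      A (fun j => x (i.succAbove j)) (fun j => y (i.succAbove j))
    else 0

/-- `ψ` is `i`-alignable. -/
def IAlignable {k : ℕ} (i : Fin (k + 1)) (ψ : Vec G (k + 1)) : Prop :=
  ∃ (θ : ℝ) (U : Op G (k + 1)) (φ : (Fin k → G) → ℂ),
    U ∈ Usym G k ∧ ψ = Complex.exp (θ * Complex.I) • U.mulVec (insVec i φ)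

/-- `ψ` is alignable. -/
def Alignable {k : ℕ} (ψ : Vec G (k + 1)) : Prop := ∃ i, IAlignable i ψ

/-- Symmetry equivalence of state vectors (up to a global phase). -/
def SymmEquiv {k : ℕ} (ψ ψ' : Vec G (k + 1)) : Prop :=
  ∃ (θ : ℝ) (U : Op G (k + 1)),
    U ∈ Usym G k ∧ ψ' = Complex.exp (θ * Complex.I) • U.mulVec ψ

/-- `P` is the orthogonal projection of operator space onto the set `S`,
with respect to the Hilbert–Schmidt inner product. -/
def IsHSProj {K : ℕ} (S : Set (Op G K)) (P : Op G K →ₗ[ℂ] Op G K) : Prop :=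
  (∀ ρ, P ρ ∈ S) ∧ (∀ A ∈ S, P A = A) ∧
    ∀ ρ σ, hsInner (P ρ) σ = hsInner ρ (P σ)

/-- First `n+1` components of an `(n+1)+(m+1)`-particle configuration. -/
def split1 {n m : ℕ} (x : Fin (n + m + 1 + 1) → G) : Fin (n + 1) → G :=
  fun i => x ⟨i.1, by have := i.2; omega⟩

/-- Last `m+1` components of an `(n+1)+(m+1)`-particle configuration. -/
def split2 {n m : ℕ} (x : Fin (n + m + 1 + 1) → G) : Fin (m + 1) → G :=
  fun i => x ⟨n + 1 + i.1, by have := i.2; omega⟩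

/-- The tensor product `A ⊗ B` of operators, under the identification
`H_{N+M} ≅ H_N ⊗ H_M`, `|x,y⟩ ↦ |x⟩ ⊗ |y⟩`. -/
def tensorOp {n m : ℕ} (A : Op G (n + 1)) (B : Op G (m + 1)) :
    Op G (n + m + 1 + 1) :=
  Matrix.of fun x y => A (split1 x) (split1 y) * B (split2 x) (split2 y)

/-- Concatenation `(h, g⃗)` of relation tuples. -/
def relcat {n m : ℕ} (h : Fin n → G) (gv : Fin (m + 1) → G) :
    Fin (n + m + 1) → G :=
  (Fin.append h gv : Fin (n + (m + 1)) → G)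

/-- Joining of configurations `(x, z)`. -/
def join {n m : ℕ} (x : Fin (n + 1) → G) (z : Fin (m + 1) → G) :
    Fin (n + m + 1 + 1) → G :=
  fun i => if hi : i.1 < n + 1 then x ⟨i.1, hi⟩
           else z ⟨i.1 - (n + 1), by have := i.2; omega⟩

/-- The standard partial trace over the last `m+1` particles. -/
def ptraceM {n m : ℕ} (ρ : Op G (n + m + 1 + 1)) : Op G (n + 1) :=
  Matrix.of fun x y => ∑ z : Fin (m + 1) → G, ρ (join x z) (join y z)

end Defs

section Kets

variable {G : Type} [CommGroup G]

theorem mul_cfg {k : ℕ} (a : G) (h : Fin k → G) (g : G) :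
    (fun i => a * cfg h g i) = cfg h (a * g) := by
  ext i
  refine Fin.cases ?_ (fun j => ?_) i
  · simp [cfg]
  · simp [cfg, mul_left_comm]

theorem exists_eq_cfg {k : ℕ} (x : Fin (k + 1) → G) : ∃ h g, x = cfg h g := by
  refine ⟨fun i => x i.succ * (x 0)⁻¹, x 0, ?_⟩
  ext i
  refine Fin.cases ?_ (fun j => ?_) i <;> simp [cfg]

variable [Fintype G] [DecidableEq G]

theorem trans_mulVec_ket {K : ℕ} (g : G) (x : Fin K → G) :
    (trans g).mulVec (ket x) = ket fun i => g * x i := by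
  ext y
  simp [Matrix.mulVec, dotProduct, trans, ket]

theorem trans_mulVec_ket_cfg {k : ℕ} (a : G) (h : Fin k → G) (g : G) :
    (trans a).mulVec (ket (cfg h g)) = ket (cfg h (a * g)) := by
  rw [trans_mulVec_ket, mul_cfg]

end Kets

/-- A unitary `U` on `H_N` maps classical configurations to classical
configurations, preserves relative positions on them, and is compatible with global
translations, if and only if it is a relation-conditional global translation
`U|g,hg⟩ = T_{c(h)}|g,hg⟩ = |c(h)g, h(c(h)g)⟩` for some `c : G^{N-1} → G`. -/
theorem stmt0 (G : Type) [Fintype G] [DecidableEq G] [CommGroup G] (n : ℕ)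
    (U : Op G (n + 1)) (hU : U ∈ Matrix.unitaryGroup (Fin (n + 1) → G) ℂ) :
    ((∀ x : Fin (n + 1) → G, ∃ y : Fin (n + 1) → G, U.mulVec (ket x) = ket y) ∧
      (∀ (g : G) (h : Fin n → G), ∃ g' : G,
        U.mulVec (ket (cfg h g)) = ket (cfg h g')) ∧
      (∀ (g : G) (x y : Fin (n + 1) → G), ket x = (trans g).mulVec (ket y) →
        U.mulVec (ket x) = (trans g).mulVec (U.mulVec (ket y)))) ↔
      ∃ c : (Fin n → G) → G, ∀ (g : G) (h : Fin n → G),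
        U.mulVec (ket (cfg h g)) = (trans (c h)).mulVec (ket (cfg h g)) ∧
        U.mulVec (ket (cfg h g)) = ket (cfg h (c h * g)) := by
  constructor
  · rintro ⟨-, hrel, htrans⟩
    choose c hc using hrel 1
    have key (g : G) (h : Fin n → G) :
        U.mulVec (ket (cfg h g)) = ket (cfg h (c h * g)) := by
      rw [htrans g (cfg h g) (cfg h 1) (by rw [trans_mulVec_ket_cfg, mul_one]), hc,
        trans_mulVec_ket_cfg, mul_comm]
    exact ⟨c, fun g h => ⟨by rw [key, trans_mulVec_ket_cfg], key g h⟩⟩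
  · rintro ⟨c, hc⟩
    have key (g : G) (h : Fin n → G) := (hc g h).2
    refine ⟨fun x => ?_, fun g h => ⟨c h * g, key g h⟩, fun g x y hxy => ?_⟩
    · obtain ⟨h, g, rfl⟩ := exists_eq_cfg x
      exact ⟨_, key g h⟩
    · obtain ⟨h, a, rfl⟩ := exists_eq_cfg y
      rw [hxy, trans_mulVec_ket_cfg, key, key, trans_mulVec_ket_cfg, mul_left_comm]

end QRF

end
end

section
/- For every ρ ∈ L(H_N), Π_inv(ρ) = Π_phys ρ Π_phys + Σ_{h∈G^{N−1}} Σ_{χ∈Ĝ, χ≠𝟙} ⟨h;χ|ρ|h;χ⟩ |h;χ⟩⟨h;χ|, and Π_inv is the orthogonal projection of L(H_N), with respect to the Hilbert–Schmidt inner product ⟨A,B⟩ := tr(A†B), onto A_inv. Similarly, Π'_inv(ρ) := |G|⁻¹ Σ_{g∈G} T_g ρ T_g† is the orthogonal projection of L(H_N) onto A'_inv := {A ∈ L(H_N) : T_g A T_g† = A for all g ∈ G} = {A : ⟨h;χ|A|h';χ'⟩ = 0 whenever χ ≠ χ'}. Moreover, if |G| ≥ 2 and N ≥ 2 then A_inv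 is a strict subset of A'_inv. -/
noncomputable section

open Matrix

namespace QRF

/-- The algebra `A'_inv` of operators invariant under all global translations. -/
def Ainv' (G : Type) [Fintype G] [DecidableEq G] [CommGroup G] (k : ℕ) :
    Set (Op G (k + 1)) :=
  {A | ∀ g : G, trans g * A * (trans g)ᴴ = A}

/-- The incoherent group average (`G`-twirl) `Π'_inv` over the global translations. -/
def Piinv' (G : Type) [Fintype G] [DecidableEq G] [CommGroup G] (k : ℕ)
    (ρ : Op G (k + 1)) : Op G (k + 1) :=
  (Fintype.card G : ℂ)⁻¹ • ∑ g : G, trans g * ρ * (trans g)ᴴ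

section Twirl

variable {Γ m : Type*} [Group Γ] [Fintype Γ] [Fintype m] [DecidableEq m]

/-- The average of `V g * A * (V g)ᴴ` over a finite group. -/
def twirl (V : Γ →* Matrix m m ℂ) (A : Matrix m m ℂ) : Matrix m m ℂ :=
  (Fintype.card Γ : ℂ)⁻¹ • ∑ g : Γ, V g * A * (V g)ᴴ

theorem conj_twirl (V : Γ →* Matrix m m ℂ) (A : Matrix m m ℂ) (g : Γ) :
    V g * twirl V A * (V g)ᴴ = twirl V A := by
  unfold twirl
  rw [Matrix.mul_smul, Matrix.smul_mul, Matrix.mul_sum, Matrix.sum_mul]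
  congr 1
  refine Fintype.sum_equiv (Equiv.mulLeft g) _ _ fun k => ?_
  simp [Matrix.conjTranspose_mul, Matrix.mul_assoc]

theorem twirl_eq_self (V : Γ →* Matrix m m ℂ) {A : Matrix m m ℂ}
    (hA : ∀ g, V g * A * (V g)ᴴ = A) : twirl V A = A := by
  have hc : (Fintype.card Γ : ℂ) ≠ 0 := Nat.cast_ne_zero.2 Fintype.card_ne_zero
  simp only [twirl, hA, Finset.sum_const, Finset.card_univ, ← Nat.cast_smul_eq_nsmul ℂ, smul_smul,
    inv_mul_cancel₀ hc, one_smul]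

theorem trace_conjTranspose_twirl_mul (V : Γ →* Matrix m m ℂ)
    (hV : ∀ g, (V g)ᴴ = V g⁻¹) (A B : Matrix m m ℂ) :
    ((twirl V A)ᴴ * B).trace = (Aᴴ * twirl V B).trace := by
  simp only [twirl, Matrix.conjTranspose_smul, Matrix.conjTranspose_sum, Matrix.smul_mul,
    Matrix.mul_smul, Matrix.sum_mul, Matrix.mul_sum, Matrix.trace_smul, Matrix.trace_sum,
    star_inv₀, star_natCast]
  congr 1
  refine Fintype.sum_equiv (Equiv.inv Γ) _ _ fun g => ?_
  simp only [Matrix.conjTranspose_mul, hV, Equiv.inv_apply, inv_inv, Matrix.mul_assoc]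
  rw [Matrix.trace_mul_comm]
  simp only [Matrix.mul_assoc]

theorem twirl_sum_smul {ι : Type*} [Fintype ι] (V : Γ →* Matrix m m ℂ) (a : ι → ℂ) (A : ι → Matrix m m ℂ) :
    twirl V (∑ i, a i • A i) = ∑ i, a i • twirl V (A i) := by
  simp only [twirl, Matrix.mul_sum, Matrix.sum_mul, Matrix.mul_smul, Matrix.smul_mul]
  rw [Finset.sum_comm, Finset.smul_sum]
  refine Finset.sum_congr rfl fun i _ => ?_
  rw [← Finset.smul_sum, smul_comm]

end Twirl

section Outer

variable {G : Type} {K : ℕ}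

theorem outer_eq_vecMulVec (v w : Vec G K) : outer v w = vecMulVec v (star w) := rfl

theorem outer_smul_smul (a b : ℂ) (v w : Vec G K) :
    outer (a • v) (b • w) = (a * star b) • outer v w := by
  ext x y
  simp [outer]
  ring

variable [Fintype G]

theorem conj_outer (M : Op G K) (v w : Vec G K) :
    M * outer v w * Mᴴ = outer (M.mulVec v) (M.mulVec w) := by
  rw [outer_eq_vecMulVec, outer_eq_vecMulVec, mul_vecMulVec, vecMulVec_mul, star_mulVec]

theorem outer_mul_mul_outer (v w : Vec G K) (A : Op G K) :
    outer v v * A * outer w w = melem v A w • outer v w := by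
  rw [outer_eq_vecMulVec, outer_eq_vecMulVec, outer_eq_vecMulVec, vecMulVec_mul,
    vecMulVec_mul_vecMulVec, ← dotProduct_mulVec, vecMulVec_smul, melem]

theorem melem_conj (v w : Vec G K) (M A : Op G K) :
    melem v (M * A * Mᴴ) w = melem (Mᴴ.mulVec v) A (Mᴴ.mulVec w) := by
  simp only [melem, star_mulVec, conjTranspose_conjTranspose, ← mulVec_mulVec, dotProduct_mulVec,
    vecMul_vecMul, Matrix.mul_assoc]

theorem melem_smul_smul (a b : ℂ) (v w : Vec G K) (A : Op G K) :
    melem (a • v) A (b • w) = star a * b * melem v A w := by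
  simp [melem, mulVec_smul]
  ring

end Outer

section Characters

variable {G : Type} [CommGroup G]

theorem Ghat.ext {χ χ' : Ghat G} (h : ∀ g, χ.1 g = χ'.1 g) : χ = χ' :=
  Subtype.ext (MonoidHom.ext h)

theorem Ghat.exists_apply_ne {χ χ' : Ghat G} (h : χ ≠ χ') : ∃ g, χ.1 g ≠ χ'.1 g := by
  by_contra! hall
  exact h (Ghat.ext hall)

theorem Ghat.apply_mul_star (χ : Ghat G) (g : G) : χ.1 g * star (χ.1 g) = 1 := by
  have := Complex.mul_conj' (χ.1 g)
  rw [χ.2 g] at this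
  simpa using this

theorem Ghat.star_apply (χ : Ghat G) (g : G) : star (χ.1 g) = χ.1 g⁻¹ := by
  have h1 : χ.1 g⁻¹ * χ.1 g = 1 := by rw [← map_mul, inv_mul_cancel, map_one]
  calc star (χ.1 g) = χ.1 g⁻¹ * χ.1 g * star (χ.1 g) := by rw [h1, one_mul]
    _ = χ.1 g⁻¹ := by rw [mul_assoc, Ghat.apply_mul_star, mul_one]

/-- Characters of `G` are additive characters of `Additive G`. -/
def ghatEquivAddChar [Finite G] : Ghat G ≃ AddChar (Additive G) ℂ where
  toFun χ := AddChar.toMonoidHomEquiv.symm (χ.1.comp (MulEquiv.multiplicativeAdditive G).toMonoidHom)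
  invFun ψ := ⟨ψ.toMonoidHom.comp (MulEquiv.multiplicativeAdditive G).symm.toMonoidHom,
    fun g => ψ.norm_apply (Additive.ofMul g)⟩
  left_inv _ := rfl
  right_inv _ := rfl

instance [Finite G] : Finite (Ghat G) := Finite.of_equiv _ ghatEquivAddChar.symm

theorem sum_ghat_apply [Fintype G] [DecidableEq G] [Fintype (Ghat G)] (g : G) :
    ∑ χ : Ghat G, χ.1 g = if g = 1 then (Fintype.card G : ℂ) else 0 := by
  have h := AddChar.sum_apply_eq_ite (Additive.ofMul g)
  rw [Fintype.sum_equiv ghatEquivAddChar (fun χ : Ghat G => χ.1 g)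
    (fun ψ => ψ (Additive.ofMul g)) fun _ => rfl, h]
  exact if_congr ofMul_eq_zero (by rw [Fintype.card_additive]) rfl

end Characters

section Config

variable {G : Type} [CommGroup G] {n : ℕ}

/-- The relations `(x₁ x₀⁻¹, …, xₙ x₀⁻¹)` of a configuration `x`. -/
def rel (x : Fin (n + 1) → G) : Fin n → G := fun i => x i.succ * (x 0)⁻¹

theorem cfg_rel (x : Fin (n + 1) → G) : cfg (rel x) (x 0) = x := by
  funext i
  refine Fin.cases ?_ (fun j => ?_) i <;> simp [cfg, rel]

theorem rel_cfg (h : Fin n → G) (g : G) : rel (cfg h g) = h := by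
  funext i
  simp [cfg, rel]

theorem rel_mul_left (a : G) (x : Fin (n + 1) → G) : rel (fun i => a * x i) = rel x := by
  funext i
  simp only [rel, mul_inv]
  rw [mul_mul_mul_comm, mul_inv_cancel, one_mul]

theorem mul_left_cfg (h : Fin n → G) (a g : G) : (fun i => a * cfg h g i) = cfg h (a * g) := by
  funext i
  refine Fin.cases ?_ (fun j => ?_) i
  · simp [cfg]
  · simp [cfg, mul_left_comm]

theorem eq_cfg_iff (x : Fin (n + 1) → G) (h : Fin n → G) (g : G) :
    x = cfg h g ↔ rel x = h ∧ x 0 = g := by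
  constructor
  · rintro rfl
    exact ⟨rel_cfg h g, rfl⟩
  · rintro ⟨rfl, rfl⟩
    exact (cfg_rel x).symm

end Config

theorem ket_eq_single {G : Type} [DecidableEq G] {K : ℕ} (x : Fin K → G) : ket x = Pi.single x (1 : ℂ) := by
  funext y
  simp [ket, Pi.single_apply]

section CondTrans

variable {G : Type} [Fintype G] [DecidableEq G] [CommGroup G] {n : ℕ}

/-- The relation-conditional translation `|g, hg⟩ ↦ T_{c(h)} |g, hg⟩`, as a representation. -/
def condTrans : ((Fin n → G) → G) →* Op G (n + 1) where
  toFun c := Matrix.of fun x y => if x = (fun i => c (rel y) * y i) then 1 else 0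
  map_one' := by
    ext x y
    simp [Matrix.one_apply]
  map_mul' c d := by
    ext x y
    simp [Matrix.mul_apply, rel_mul_left, mul_assoc]

theorem condTrans_apply (c : (Fin n → G) → G) (x y : Fin (n + 1) → G) :
    condTrans c x y = if x = (fun i => c (rel y) * y i) then 1 else 0 := rfl

theorem condTrans_conjTranspose (c : (Fin n → G) → G) :
    (condTrans c)ᴴ = condTrans c⁻¹ := by
  ext x y
  rw [conjTranspose_apply, condTrans_apply, condTrans_apply, apply_ite star, star_one, star_zero]
  refine if_congr ⟨?_, ?_⟩ rfl rfl
  · rintro rfl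
    simp [rel_mul_left]
  · rintro rfl
    simp [rel_mul_left]

theorem trans_eq_condTrans (g : G) : (trans g : Op G (n + 1)) = condTrans fun _ => g := rfl

theorem condTrans_mulVec_ket_cfg (c : (Fin n → G) → G) (h : Fin n → G) (g : G) :
    (condTrans c).mulVec (ket (cfg h g)) = ket (cfg h (c h * g)) := by
  rw [ket_eq_single, mulVec_single_one]
  funext x
  simp only [col_apply, condTrans_apply, ket, rel_cfg, mul_left_cfg]

theorem condTrans_injective :
    Function.Injective (condTrans : ((Fin n → G) → G) →* Op G (n + 1)) := by
  intro c d hcd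
  funext h
  have key := condTrans_mulVec_ket_cfg c h 1
  rw [hcd, condTrans_mulVec_ket_cfg] at key
  have h0 := congrFun key (cfg h (c h * 1))
  have h1 : cfg h (c h) = cfg h (d h) := by simpa [ket] using h0
  exact congrFun h1 0

theorem Usym_eq_range : Usym G n = Set.range (condTrans : ((Fin n → G) → G) →* Op G (n + 1)) := by
  ext U
  constructor
  · rintro ⟨-, c, hc⟩
    refine ⟨c, Matrix.ext_of_mulVec_single fun x => ?_⟩
    rw [← ket_eq_single, ← cfg_rel x, hc, trans_eq_condTrans, condTrans_mulVec_ket_cfg,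
      condTrans_mulVec_ket_cfg]
  · rintro ⟨c, rfl⟩
    refine ⟨?_, c, fun h g => ?_⟩
    · rw [mem_unitaryGroup_iff, star_eq_conjTranspose, condTrans_conjTranspose, ← map_mul,
        mul_inv_cancel, map_one]
    · rw [trans_eq_condTrans, condTrans_mulVec_ket_cfg, condTrans_mulVec_ket_cfg]

theorem Piinv_eq_twirl (ρ : Op G (n + 1)) : Piinv G n ρ = twirl condTrans ρ := by
  unfold Piinv twirl
  rw [Usym_eq_range, finsum_mem_range condTrans_injective, finsum_eq_sum_of_fintype,
    Nat.card_range_of_injective condTrans_injective, Nat.card_eq_fintype_card]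

theorem mem_Ainv_iff (A : Op G (n + 1)) :
    A ∈ Ainv G n ↔ ∀ c, condTrans c * A * (condTrans c)ᴴ = A := by
  simp [Ainv, Usym_eq_range]

/-- The global translations as a representation of `G`. -/
def transHom : G →* Op G (n + 1) := condTrans.comp (Pi.constMonoidHom (Fin n → G) G)

theorem transHom_conjTranspose (g : G) :
    (transHom g : Op G (n + 1))ᴴ = transHom g⁻¹ :=
  condTrans_conjTranspose fun _ => g

theorem mem_Ainv'_iff (A : Op G (n + 1)) :
    A ∈ Ainv' G n ↔ ∀ g, transHom g * A * (transHom g)ᴴ = A := Iff.rfl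

theorem Piinv'_eq_twirl (ρ : Op G (n + 1)) : Piinv' G n ρ = twirl transHom ρ := rfl

theorem condTrans_mulVec_relKet (c : (Fin n → G) → G) (h : Fin n → G) (χ : Ghat G) :
    (condTrans c).mulVec (relKet h χ) = χ.1 (c h) • relKet h χ := by
  rw [relKet, mulVec_smul, mulVec_sum, smul_comm (χ.1 (c h))]
  congr 1
  rw [Finset.smul_sum]
  refine Fintype.sum_equiv (Equiv.mulLeft (c h)) _ _ fun g => ?_
  rw [mulVec_smul, condTrans_mulVec_ket_cfg, smul_smul, ← map_mul]
  simp

theorem relKet_apply (h : Fin n → G) (χ : Ghat G) (x : Fin (n + 1) → G) :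
    relKet h χ x = (Real.sqrt (Fintype.card G) : ℂ)⁻¹ *
      if rel x = h then χ.1 (x 0)⁻¹ else 0 := by
  simp only [relKet, Pi.smul_apply, Finset.sum_apply, smul_eq_mul, ket, eq_cfg_iff]
  congr 1
  split_ifs with hx <;> simp [hx]

theorem sum_outer_relKet [Fintype (Ghat G)] :
    ∑ h : Fin n → G, ∑ χ : Ghat G, outer (relKet h χ) (relKet h χ) = 1 := by
  have hc : (Fintype.card G : ℂ) ≠ 0 := Nat.cast_ne_zero.2 Fintype.card_ne_zero
  have hs : (Real.sqrt (Fintype.card G) : ℂ)⁻¹ * (Real.sqrt (Fintype.card G) : ℂ)⁻¹ =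
      (Fintype.card G : ℂ)⁻¹ := by
    rw [← mul_inv, ← Complex.ofReal_mul, Real.mul_self_sqrt (Nat.cast_nonneg _),
      Complex.ofReal_natCast]
  ext x y
  have hterm : ∀ (h : Fin n → G) (χ : Ghat G), outer (relKet h χ) (relKet h χ) x y =
      if rel x = h then (if rel y = h then
        (Fintype.card G : ℂ)⁻¹ * χ.1 ((x 0)⁻¹ * y 0) else 0) else 0 := by
    intro h χ
    have hstar := Ghat.star_apply χ (y 0)⁻¹
    rw [inv_inv] at hstar
    simp only [outer, Matrix.of_apply, relKet_apply]
    split_ifs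
    · rw [map_mul (starRingEnd ℂ), map_inv₀, Complex.conj_ofReal, starRingEnd_apply, hstar,
        map_mul, ← hs]
      ring
    all_goals simp
  simp only [Matrix.sum_apply, hterm]
  rw [Finset.sum_comm]
  simp only [Finset.sum_ite_eq, Finset.mem_univ, if_true]
  by_cases hr : rel y = rel x
  · simp only [hr, if_true]
    rw [← Finset.mul_sum, sum_ghat_apply, Matrix.one_apply]
    by_cases h0 : x 0 = y 0
    · have hxy : x = y := by rw [← cfg_rel x, ← cfg_rel y, hr, h0]
      simp [hxy, hc]
    · rw [if_neg (by rwa [inv_mul_eq_one]), if_neg (fun hxy => h0 (by rw [hxy])), mul_zero]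
  · rw [Matrix.one_apply, if_neg (fun hxy => hr (by rw [hxy]))]
    simp [hr]

theorem eq_sum_melem_smul_outer [Fintype (Ghat G)] (A : Op G (n + 1)) :
    A = ∑ p : (Fin n → G) × Ghat G, ∑ q : (Fin n → G) × Ghat G,
      melem (relKet p.1 p.2) A (relKet q.1 q.2) • outer (relKet p.1 p.2) (relKet q.1 q.2) := by
  have h1 : ∑ p : (Fin n → G) × Ghat G, outer (relKet p.1 p.2) (relKet p.1 p.2) = 1 := by
    rw [Fintype.sum_prod_type]
    exact sum_outer_relKet
  simp only [← outer_mul_mul_outer, ← Finset.mul_sum, ← Finset.sum_mul, h1, Matrix.one_mul,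
    Matrix.mul_one]

theorem condTrans_conj_outer_relKet (c : (Fin n → G) → G) (h h' : Fin n → G) (χ χ' : Ghat G) :
    condTrans c * outer (relKet h χ) (relKet h' χ') * (condTrans c)ᴴ =
      (χ.1 (c h) * star (χ'.1 (c h'))) • outer (relKet h χ) (relKet h' χ') := by
  rw [conj_outer, condTrans_mulVec_relKet, condTrans_mulVec_relKet, outer_smul_smul]

end CondTrans

section Average

variable {G : Type} [Fintype G] [CommGroup G] {ι : Type*} [Fintype ι]
  [DecidableEq ι]

/-- A nontrivial character of the group of functions `ι → G` has vanishing average. -/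
theorem sum_char_mul_star_char_eq_zero {i j : ι} {χ χ' : Ghat G} (d : ι → G)
    (hd : χ.1 (d i) * star (χ'.1 (d j)) ≠ 1) :
    ∑ c : ι → G, χ.1 (c i) * star (χ'.1 (c j)) = 0 := by
  have key : ∑ c : ι → G, χ.1 (c i) * star (χ'.1 (c j)) =
      (χ.1 (d i) * star (χ'.1 (d j))) * ∑ c : ι → G, χ.1 (c i) * star (χ'.1 (c j)) := by
    rw [Finset.mul_sum]
    refine Fintype.sum_equiv (Equiv.mulLeft d).symm _ _ fun c => ?_
    simp only [Equiv.mulLeft_symm_apply, Pi.mul_apply, Pi.inv_apply, map_mul, star_mul']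
    have h1 : χ.1 (d i) * χ.1 (d i)⁻¹ = 1 := by rw [← map_mul, mul_inv_cancel, map_one]
    have h2 : star (χ'.1 (d j)) * star (χ'.1 (d j)⁻¹) = 1 := by
      rw [← star_mul', ← map_mul, mul_inv_cancel, map_one, star_one]
    linear_combination (-(χ.1 (c i) * star (χ'.1 (c j)))) * h1 -
      χ.1 (c i) * star (χ'.1 (c j)) * χ.1 (d i) * χ.1 (d i)⁻¹ * h2
  by_contra hne
  exact hd (mul_right_cancel₀ hne (key.symm.trans (one_mul _).symm))

theorem average_char_mul_star_char [DecidableEq (Ghat G)] (i j : ι) (χ χ' : Ghat G) :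
    (Fintype.card (ι → G) : ℂ)⁻¹ * ∑ c : ι → G, χ.1 (c i) * star (χ'.1 (c j)) =
      (if χ = 1 then (if χ' = 1 then 1 else 0) else 0) +
        if i = j then (if χ = χ' then (if χ ≠ 1 then 1 else 0) else 0) else 0 := by
  have hc : (Fintype.card (ι → G) : ℂ) ≠ 0 := Nat.cast_ne_zero.2 Fintype.card_ne_zero
  have hone : ∀ g : G, (1 : Ghat G).1 g = 1 := fun _ => rfl
  by_cases hij : i = j
  · subst hij
    by_cases hχ : χ = χ'
    · subst hχ
      have : (Fintype.card (ι → G) : ℂ)⁻¹ * ∑ c : ι → G, χ.1 (c i) * star (χ.1 (c i)) = 1 := by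
        simp only [Ghat.apply_mul_star, Finset.sum_const, Finset.card_univ, nsmul_eq_mul, mul_one,
          inv_mul_cancel₀ hc]
      rw [this]
      by_cases h1 : χ = 1 <;> simp [h1]
    · obtain ⟨g, hg⟩ := Ghat.exists_apply_ne hχ
      rw [sum_char_mul_star_char_eq_zero (fun _ => g) fun h => hg ?_]
      · by_cases h1 : χ = 1
        · subst h1
          simp [hχ, Ne.symm hχ]
        · simp [h1, hχ]
      · have h2 := Ghat.apply_mul_star χ' g
        have h3 : star (χ'.1 g) ≠ 0 := right_ne_zero_of_mul_eq_one h2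
        exact mul_right_cancel₀ h3 (h.trans h2.symm)
  · by_cases h1 : χ = 1
    · by_cases h2 : χ' = 1
      · simp [h1, h2, hij, hone]
      · obtain ⟨g, hg⟩ := Ghat.exists_apply_ne h2
        rw [sum_char_mul_star_char_eq_zero (Function.update 1 j g)]
        · simp [h1, h2, hij]
        · rw [Function.update_of_ne hij, Function.update_self, Pi.one_apply, map_one, one_mul]
          intro h
          exact hg (star_injective (h.trans (by rw [hone, star_one])))
    · obtain ⟨g, hg⟩ := Ghat.exists_apply_ne h1
      rw [sum_char_mul_star_char_eq_zero (Function.update 1 i g)]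
      · simp [h1, hij]
      · rw [Function.update_of_ne (Ne.symm hij), Function.update_self, Pi.one_apply, map_one,
          star_one, mul_one]
        exact hg

end Average

section Main

variable {G : Type} [Fintype G] [DecidableEq G] [CommGroup G] {n : ℕ}

theorem twirl_condTrans_outer [DecidableEq (Ghat G)] (h h' : Fin n → G) (χ χ' : Ghat G) :
    twirl condTrans (outer (relKet h χ) (relKet h' χ')) =
      ((if χ = 1 then (if χ' = 1 then 1 else 0) else 0) +
        if h = h' then (if χ = χ' then (if χ ≠ 1 then 1 else 0) else 0) else 0 : ℂ) •
        outer (relKet h χ) (relKet h' χ') := by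
  simp only [twirl, condTrans_conj_outer_relKet, ← Finset.sum_smul, smul_smul,
    average_char_mul_star_char]

theorem Piphys_conj (ρ : Op G (n + 1)) :
    Piphys G n * ρ * Piphys G n = ∑ h : Fin n → G, ∑ h' : Fin n → G,
      melem (relKet h 1) ρ (relKet h' 1) • outer (relKet h 1) (relKet h' 1) := by
  simp only [Piphys, ← outer_mul_mul_outer, ← Finset.mul_sum, ← Finset.sum_mul]

theorem Piinv_eq (ρ : Op G (n + 1)) :
    Piinv G n ρ = Piphys G n * ρ * Piphys G n +
      ∑ h : Fin n → G, ∑ᶠ (χ : Ghat G) (_ : χ ≠ 1),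
        melem (relKet h χ) ρ (relKet h χ) • outer (relKet h χ) (relKet h χ) := by
  classical
  have := Fintype.ofFinite (Ghat G)
  have hfin : ∀ f : Ghat G → Op G (n + 1), ∑ᶠ (χ : Ghat G) (_ : χ ≠ 1), f χ =
      ∑ χ : Ghat G, if χ ≠ 1 then f χ else 0 := by
    intro f
    simp only [finsum_eq_if, finsum_eq_sum_of_fintype]
  simp only [hfin]
  rw [Piinv_eq_twirl, Piphys_conj]
  conv_lhs => rw [eq_sum_melem_smul_outer ρ]
  rw [← Fintype.sum_prod_type', twirl_sum_smul, Fintype.sum_prod_type]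
  simp only [twirl_condTrans_outer, Fintype.sum_prod_type, add_smul, smul_add,
    Finset.sum_add_distrib, ite_smul, smul_ite, zero_smul, smul_zero, one_smul]
  congr 1
  · simp
  · simp

theorem Ainv'_eq : Ainv' G n =
    {A : Op G (n + 1) | ∀ (h h' : Fin n → G) (χ χ' : Ghat G), χ ≠ χ' →
      melem (relKet h χ) A (relKet h' χ') = 0} := by
  have := Fintype.ofFinite (Ghat G)
  ext A
  constructor
  · intro hA h h' χ χ' hχ
    obtain ⟨g, hg⟩ := Ghat.exists_apply_ne hχ
    have key := melem_conj (relKet h χ) (relKet h' χ') (trans g) A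
    rw [hA g, trans_eq_condTrans, condTrans_conjTranspose, condTrans_mulVec_relKet,
      condTrans_mulVec_relKet, melem_smul_smul, Pi.inv_apply, Pi.inv_apply, Ghat.star_apply,
      inv_inv, ← Ghat.star_apply] at key
    by_contra hne
    have h1 : χ.1 g * star (χ'.1 g) = 1 :=
      mul_right_cancel₀ hne (key.symm.trans (one_mul _).symm)
    have h2 := Ghat.apply_mul_star χ' g
    exact hg (mul_right_cancel₀ (right_ne_zero_of_mul_eq_one h2) (h1.trans h2.symm))
  · intro hA g
    conv_rhs => rw [eq_sum_melem_smul_outer A]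
    conv_lhs => rw [eq_sum_melem_smul_outer A]
    simp only [Matrix.mul_sum, Matrix.sum_mul, Matrix.mul_smul, Matrix.smul_mul,
      trans_eq_condTrans, condTrans_conj_outer_relKet]
    refine Finset.sum_congr rfl fun p _ => Finset.sum_congr rfl fun q _ => ?_
    by_cases hpq : p.2 = q.2
    · rw [hpq, Ghat.apply_mul_star, one_smul]
    · rw [hA _ _ _ _ hpq, zero_smul, zero_smul]

theorem condTrans_conj_apply (c : (Fin n → G) → G) (A : Op G (n + 1)) (h h' : Fin n → G)
    (g g' : G) : (condTrans c * A * (condTrans c)ᴴ) (cfg h (c h * g)) (cfg h' (c h' * g')) =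
      A (cfg h g) (cfg h' g') := by
  have hrow : ∀ (k : Fin n → G) (a : G) (y : Fin (n + 1) → G),
      condTrans c (cfg k (c k * a)) y = if y = cfg k a then 1 else 0 := by
    intro k a y
    rw [condTrans_apply]
    refine if_congr ⟨fun hy => ?_, ?_⟩ rfl rfl
    · rw [eq_comm, eq_cfg_iff, rel_mul_left] at hy
      rw [eq_cfg_iff]
      obtain ⟨hr, h0⟩ := hy
      rw [hr] at h0
      exact ⟨hr, mul_left_cancel h0⟩
    · rintro rfl
      rw [rel_cfg, mul_left_cfg]
  simp [Matrix.mul_apply, hrow]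

theorem Ainv_ssubset_Ainv' (hG : 2 ≤ Fintype.card G) (hn : 1 ≤ n) : Ainv G n ⊂ Ainv' G n := by
  obtain ⟨a, ha⟩ := Fintype.exists_ne_of_one_lt_card hG (1 : G)
  refine ⟨fun A hA g => (mem_Ainv_iff A).1 hA fun _ => g, fun hsub => ?_⟩
  have hB : (Matrix.of fun x y => if x 0 = y 0 then 1 else 0 : Op G (n + 1)) ∈ Ainv' G n := by
    intro g
    ext x y
    rw [trans_eq_condTrans, ← cfg_rel x, ← cfg_rel y, ← mul_inv_cancel_left g (x 0),
      ← mul_inv_cancel_left g (y 0), condTrans_conj_apply (fun _ => g)]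
    simp [cfg]
  have hne : (fun _ => a : Fin n → G) ≠ 1 := fun h => ha (congrFun h ⟨0, hn⟩)
  have key := condTrans_conj_apply (Function.update 1 1 a)
    (Matrix.of fun x y => if x 0 = y 0 then 1 else 0 : Op G (n + 1)) 1 (fun _ => a) 1 1
  rw [(mem_Ainv_iff _).1 (hsub hB)] at key
  simp [cfg, Function.update_of_ne hne, ha] at key

end Main

/-- Explicit form of `Π_inv`; `Π_inv` is the HS-orthogonal projection
onto `A_inv`; `Π'_inv` is the HS-orthogonal projection onto `A'_inv`, which consists
exactly of the operators block-diagonal in the character `χ`; and for `|G| ≥ 2`,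
`N ≥ 2`, `A_inv` is a strict subset of `A'_inv`. -/
theorem stmt4 (G : Type) [Fintype G] [DecidableEq G] [CommGroup G] (n : ℕ) :
    (∀ ρ : Op G (n + 1),
      Piinv G n ρ = Piphys G n * ρ * Piphys G n +
        ∑ h : Fin n → G, ∑ᶠ (χ : Ghat G) (_ : χ ≠ 1),
          melem (relKet h χ) ρ (relKet h χ) • outer (relKet h χ) (relKet h χ)) ∧
    (∀ ρ : Op G (n + 1), Piinv G n ρ ∈ Ainv G n) ∧
    (∀ A ∈ Ainv G n, Piinv G n A = A) ∧
    (∀ A B : Op G (n + 1), hsInner (Piinv G n A) B = hsInner A (Piinv G n B)) ∧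
    (∀ ρ : Op G (n + 1), Piinv' G n ρ ∈ Ainv' G n) ∧
    (∀ A ∈ Ainv' G n, Piinv' G n A = A) ∧
    (∀ A B : Op G (n + 1), hsInner (Piinv' G n A) B = hsInner A (Piinv' G n B)) ∧
    (Ainv' G n =
      {A : Op G (n + 1) | ∀ (h h' : Fin n → G) (χ χ' : Ghat G), χ ≠ χ' →
        melem (relKet h χ) A (relKet h' χ') = 0}) ∧
    (2 ≤ Fintype.card G → 1 ≤ n → Ainv G n ⊂ Ainv' G n) := by
  refine ⟨Piinv_eq, fun ρ => ?_, fun A hA => ?_, fun A B => ?_, fun ρ => ?_, fun A hA => ?_,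
    fun A B => ?_, Ainv'_eq, Ainv_ssubset_Ainv'⟩
  · rw [Piinv_eq_twirl, mem_Ainv_iff]
    intro c
    rw [conj_twirl]
  · rw [Piinv_eq_twirl, twirl_eq_self]
    rwa [mem_Ainv_iff] at hA
  · rw [Piinv_eq_twirl, Piinv_eq_twirl, hsInner, hsInner, trace_conjTranspose_twirl_mul]
    exact condTrans_conjTranspose
  · rw [Piinv'_eq_twirl, mem_Ainv'_iff]
    intro g
    rw [conj_twirl]
  · rw [Piinv'_eq_twirl, twirl_eq_self]
    rwa [mem_Ainv'_iff] at hA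
  · rw [Piinv'_eq_twirl, Piinv'_eq_twirl, hsInner, hsInner, trace_conjTranspose_twirl_mul]
    exact transHom_conjTranspose

end QRF

end
end

section
/- Let 1 ≤ i ≤ N and let ψ ∈ H_N be i-alignable, say ψ = e^{iθ} U(|e⟩_i ⊗ φ) and also ψ = e^{iθ'} U'(|e⟩_i ⊗ φ') with θ, θ' ∈ ℝ, U, U' ∈ U_sym and φ, φ' ∈ ℂ^{G^{N−1}}. Then φ and φ' agree up to a global phase: φ' = e^{iα} φ for some α ∈ ℝ. -/
noncomputable section

open Matrix

namespace QRF

/-- Matrix entries of an element of `U_sym`: every column is a translated basis vector. -/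
lemma exists_entry_of_mem_Usym {G : Type} [Fintype G] [DecidableEq G] [CommGroup G] {n : ℕ}
    {U : Op G (n + 1)} (hU : U ∈ Usym G n) (y : Fin (n + 1) → G) :
    ∃ c : G, ∀ z, U z y = if z = (fun j => c * y j) then 1 else 0 := by
  obtain ⟨-, c, hc⟩ := hU
  have hy : cfg (fun j => y j.succ * (y 0)⁻¹) (y 0) = y := by
    funext j
    refine Fin.cases ?_ (fun j => ?_) j <;> simp [cfg]
  have hcol := hc (fun j => y j.succ * (y 0)⁻¹) (y 0)
  rw [hy] at hcol
  refine ⟨c fun j => y j.succ * (y 0)⁻¹, fun z => ?_⟩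
  simpa [Matrix.mulVec, dotProduct, ket, trans] using congrFun hcol z

/-- Summing a vector over the orbits of the global translations is invariant under `U_sym`. -/
lemma sum_translate_mulVec_of_mem_Usym {G : Type} [Fintype G] [DecidableEq G] [CommGroup G]
    {n : ℕ} {U : Op G (n + 1)} (hU : U ∈ Usym G n) (v : Vec G (n + 1)) (x : Fin (n + 1) → G) :
    ∑ g : G, U.mulVec v (fun j => g * x j) = ∑ g : G, v (fun j => g * x j) := by
  have hentry (y : Fin (n + 1) → G) :
      ∑ g : G, U (fun j => g * x j) y = ∑ g : G, if (fun j => g * x j) = y then 1 else 0 := by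
    obtain ⟨c, hc⟩ := exists_entry_of_mem_Usym hU y
    rw [← Equiv.sum_comp (Equiv.mulLeft c)]
    refine Finset.sum_congr rfl fun g _ => ?_
    simp [hc, funext_iff, mul_assoc]
  simp only [Matrix.mulVec, dotProduct]
  rw [Finset.sum_comm]
  simp_rw [← Finset.sum_mul, hentry, Finset.sum_mul]
  rw [Finset.sum_comm]
  simp

/-- The orbit sums of `|e⟩_i ⊗ φ` recover `φ`. -/
lemma sum_translate_insVec {G : Type} [Fintype G] [DecidableEq G] [CommGroup G] {n : ℕ}
    (i : Fin (n + 1)) (φ : (Fin n → G) → ℂ) (y : Fin n → G) :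
    ∑ g : G, insVec i φ (fun j => g * i.insertNth (α := fun _ => G) 1 y j) = φ y := by
  simp only [insVec, Fin.insertNth_apply_same, Fin.insertNth_apply_succAbove, mul_one]
  simp

/-- If `ψ` is `i`-alignable in two ways,
`ψ = e^{iθ} U (|e⟩_i ⊗ φ) = e^{iθ'} U' (|e⟩_i ⊗ φ')`, then `φ' = e^{iα} φ`
for some real `α`: the aligned state is unique up to a global phase. -/
theorem stmt7 (G : Type) [Fintype G] [DecidableEq G] [CommGroup G] (n : ℕ)
    (i : Fin (n + 1)) (ψ : Vec G (n + 1)) (θ θ' : ℝ) (U U' : Op G (n + 1))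
    (hU : U ∈ Usym G n) (hU' : U' ∈ Usym G n)
    (φ φ' : (Fin n → G) → ℂ)
    (h1 : ψ = Complex.exp (θ * Complex.I) • U.mulVec (insVec i φ))
    (h2 : ψ = Complex.exp (θ' * Complex.I) • U'.mulVec (insVec i φ')) :
    ∃ α : ℝ, φ' = Complex.exp (α * Complex.I) • φ := by
  have hsum (y : Fin n → G) :
      Complex.exp (θ * Complex.I) * φ y = Complex.exp (θ' * Complex.I) * φ' y := by
    rw [← sum_translate_insVec i φ y, ← sum_translate_insVec i φ' y,
      ← sum_translate_mulVec_of_mem_Usym hU (insVec i φ),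
      ← sum_translate_mulVec_of_mem_Usym hU' (insVec i φ'),
      Finset.mul_sum, Finset.mul_sum]
    exact Finset.sum_congr rfl fun g _ => congrFun (h1.symm.trans h2) _
  refine ⟨θ - θ', funext fun y => mul_left_cancel₀ (Complex.exp_ne_zero (θ' * Complex.I)) ?_⟩
  rw [← hsum, Pi.smul_apply, smul_eq_mul, ← mul_assoc, ← Complex.exp_add]
  congr 2
  push_cast
  ring

end QRF

end
end
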